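/- Let A be a positive integer with A ≡ 1 or A ≡ 5 (mod 6). Suppose that for every positive integer i ≤ A with i ≡ ±1 (mod 6), the odd density δ_i of the i-multipartition function exists (i.e., the limit as x → ∞ of #{n ≤ x : p_i(n) is odd}/x exists), and suppose δ_A > 0. Then δ_1 > 0, i.e., the ordinary partition function p(n) has positive odd density. -/

import Mathlib

open Filter

/-- Number of `t`-tuples of partitions with total size `n`, i.e. the
`t`-multipartition function `p_t(n)`. -/
def multipartition (t n : ℕ) : ℕ :=
  ∑ v ∈ Finset.Nat.antidiagonalTuple t n, ∏ i, Fintype.card (Nat.Partition (v i))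

/-- Number of `n ≤ x` with `multipartition t n` odd. -/
def oddCount (t x : ℕ) : ℕ :=
  ((Finset.range (x + 1)).filter (fun n => Odd (multipartition t n))).card

/-- The odd density of the `t`-multipartition function exists and equals `δ`. -/
def hasOddDensity (t : ℕ) (δ : ℝ) : Prop :=
  Tendsto (fun x : ℕ => (oddCount t x : ℝ) / x) atTop (nhds δ)

section

/-- A set of natural numbers of asymptotic density zero. -/
def ZeroDensity (S : Set ℕ) : Prop :=
  Tendsto (fun x : ℕ => ((S ∩ Set.Iic x).ncard : ℝ) / x) atTop (nhds 0)

namespace ZeroDensity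

lemma of_le {f : ℕ → ℕ} {S : Set ℕ} (hf : Tendsto (fun x : ℕ => (f x : ℝ) / x) atTop (nhds 0))
    (h : ∀ x, (S ∩ Set.Iic x).ncard ≤ f x) : ZeroDensity S := by
  refine squeeze_zero (fun x => by positivity) (fun x => ?_) hf
  have := h x
  gcongr

lemma empty : ZeroDensity ∅ := by simp [ZeroDensity]

lemma union {S T : Set ℕ} (hS : ZeroDensity S) (hT : ZeroDensity T) : ZeroDensity (S ∪ T) := by
  refine of_le (f := fun x => (S ∩ Set.Iic x).ncard + (T ∩ Set.Iic x).ncard) ?_ fun x => ?_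
  · simpa [add_div] using hS.add hT
  · rw [Set.union_inter_distrib_right]
    exact Set.ncard_union_le _ _

/-- Density zero is inherited along injections of at most linear growth. -/
lemma of_injOn {S T : Set ℕ} (hS : ZeroDensity S) {C : ℕ} (hC : 0 < C) (φ : ℕ → ℕ)
    (hinj : Set.InjOn φ T) (hmaps : ∀ n ∈ T, φ n ∈ S) (hle : ∀ n ∈ T, φ n ≤ C * n) :
    ZeroDensity T := by
  refine of_le (f := fun x => (S ∩ Set.Iic (C * x)).ncard) ?_ fun x => ?_
  · have h := (hS.comp (tendsto_id.const_mul_atTop' hC)).const_mul (C : ℝ)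
    rw [mul_zero] at h
    refine h.congr fun x => ?_
    have : (C : ℝ) ≠ 0 := by positivity
    simp only [Function.comp, id, Nat.cast_mul]
    rw [← mul_div_assoc, mul_div_mul_left _ _ this]
  · refine Set.ncard_le_ncard_of_injOn φ (fun n hn => ⟨hmaps n hn.1, ?_⟩)
      (hinj.mono Set.inter_subset_left) ((Set.finite_Iic _).inter_of_right _)
    exact (hle n hn.1).trans (Nat.mul_le_mul_left _ hn.2)

lemma mono {S T : Set ℕ} (hS : ZeroDensity S) (h : T ⊆ S) : ZeroDensity T :=
  hS.of_injOn one_pos id Function.injective_id.injOn h (by simp)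

end ZeroDensity

open PowerSeries

/-- The series whose `n`-th coefficient is the `ℓ * n`-th coefficient of `F`. -/
noncomputable def PowerSeries.decimate {R : Type*} [Semiring R] (l : ℕ) (F : R⟦X⟧) : R⟦X⟧ :=
  PowerSeries.mk fun n => coeff (l * n) F

/-- The support of the power series has density zero. -/
def SparseSeries (F : (ZMod 2)⟦X⟧) : Prop := ZeroDensity {n | coeff n F ≠ 0}

namespace SparseSeries

lemma zero : SparseSeries 0 := by simpa [SparseSeries] using ZeroDensity.empty

lemma add {F G : (ZMod 2)⟦X⟧} (hF : SparseSeries F) (hG : SparseSeries G) :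
    SparseSeries (F + G) := by
  refine (ZeroDensity.union hF hG).mono fun n hn => ?_
  by_contra h
  simp_all

lemma sum {ι : Type*} (s : Finset ι) (F : ι → (ZMod 2)⟦X⟧) (h : ∀ i ∈ s, SparseSeries (F i)) :
    SparseSeries (∑ i ∈ s, F i) :=
  Finset.sum_induction _ _ (fun _ _ => add) zero h

lemma C_mul {F : (ZMod 2)⟦X⟧} (hF : SparseSeries F) (c : ZMod 2) : SparseSeries (C c * F) :=
  ZeroDensity.mono hF fun n hn => by
    simp only [Set.mem_ofPred_eq, coeff_C_mul] at hn
    exact right_ne_zero_of_mul hn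

lemma X_pow_mul {F : (ZMod 2)⟦X⟧} (hF : SparseSeries F) (i : ℕ) :
    SparseSeries (X ^ i * F) := by
  have key : ∀ n ∈ {n | coeff n (X ^ i * F) ≠ 0}, i ≤ n ∧ coeff (n - i) F ≠ 0 := by
    intro n hn
    simpa [coeff_X_pow_mul'] using hn
  refine ZeroDensity.of_injOn hF one_pos (fun n => n - i) ?_ (fun n hn => (key n hn).2)
    (fun n _ => by simp)
  intro a ha b hb hab
  have := (key a ha).1
  have := (key b hb).1
  simp only at hab
  omega

lemma decimate {F : (ZMod 2)⟦X⟧} (hF : SparseSeries F) {l : ℕ} (hl : 0 < l) :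
    SparseSeries (F.decimate l) :=
  ZeroDensity.of_injOn hF hl (fun n => l * n) (fun _ _ _ _ h => Nat.eq_of_mul_eq_mul_left hl h)
    (fun n hn => by simpa [PowerSeries.decimate] using hn) (fun n _ => le_rfl)

lemma expand {F : (ZMod 2)⟦X⟧} (hF : SparseSeries F) {l : ℕ} (hl : l ≠ 0) :
    SparseSeries (F.expand l hl) := by
  have key : ∀ n ∈ {n | coeff n (F.expand l hl) ≠ 0}, l ∣ n ∧ coeff (n / l) F ≠ 0 := by
    intro n hn
    simpa [coeff_expand] using hn
  refine ZeroDensity.of_injOn hF one_pos (fun n => n / l) ?_ (fun n hn => (key n hn).2)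
    (fun n _ => by simpa using Nat.div_le_self n l)
  intro a ha b hb hab
  exact (Nat.div_left_inj (key a ha).1 (key b hb).1).1 hab

end SparseSeries

/-- The generating function of the partition numbers. -/
noncomputable def partitionSeries : ℤ⟦X⟧ := PowerSeries.mk fun n => (Fintype.card n.Partition : ℤ)

lemma coeff_partitionSeries_pow (t n : ℕ) :
    coeff n (partitionSeries ^ t) = (multipartition t n : ℤ) := by
  induction t generalizing n with
  | zero => 
    cases n <;> simp [multipartition, coeff_one]
  | succ t ih =>
    rw [pow_succ', coeff_mul]
    simp only [ih]
    simp only [partitionSeries, coeff_mk]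
    simp only [multipartition]
    push_cast
    simp only [Finset.mul_sum]
    rw [Finset.sum_sigma']
    symm
    refine Finset.sum_bij' (fun v _ => ⟨(v 0, ∑ i, Fin.tail v i), Fin.tail v⟩)
      (fun x _ => Fin.cons x.1.1 x.2) ?_ ?_ ?_ ?_ ?_
    · intro v hv
      rw [Finset.Nat.mem_antidiagonalTuple, Fin.sum_univ_succ] at hv
      simp [Finset.Nat.mem_antidiagonalTuple, ← hv, Fin.tail]
    · rintro ⟨⟨a, b⟩, w⟩ hx
      simp only [Finset.mem_sigma, Finset.Nat.mem_antidiagonalTuple] at hx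
      simpa [Finset.Nat.mem_antidiagonalTuple, Fin.sum_univ_succ, hx.2] using hx.1
    · intro v _
      exact Fin.cons_self_tail v
    · rintro ⟨⟨a, b⟩, w⟩ hx
      simp only [Finset.mem_sigma, Finset.Nat.mem_antidiagonalTuple] at hx
      simp [hx.2]
    · intro v _
      rw [Fin.prod_univ_succ]
      rfl

lemma sparse_partitionSeries_pow_iff (t : ℕ) :
    SparseSeries ((partitionSeries.map (Int.castRingHom (ZMod 2))) ^ t) ↔ hasOddDensity t 0 := by
  have h : {n | coeff n ((partitionSeries.map (Int.castRingHom (ZMod 2))) ^ t) ≠ 0} =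
      {n | Odd (multipartition t n)} := by
    ext n
    rw [← map_pow, Set.mem_ofPred_eq, Set.mem_ofPred_eq, coeff_map, coeff_partitionSeries_pow,
      map_natCast, ZMod.natCast_ne_zero_iff_odd]
  unfold SparseSeries ZeroDensity hasOddDensity
  rw [h]
  refine iff_of_eq (congrArg (fun f => Tendsto f atTop (nhds (0 : ℝ))) (funext fun x => ?_))
  rw [oddCount, ← Set.ncard_coe_finset]
  congr 3
  ext n
  simp [and_comm]

end

section

open Filter PowerSeries

/-- The power series converges to `F` on the open unit disc. -/
def SumsTo (a : ℂ⟦X⟧) (F : ℂ → ℂ) : Prop :=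
  ∀ q : ℂ, ‖q‖ < 1 → HasSum (fun n => coeff n a * q ^ n) (F q)

namespace SumsTo

variable {a b : ℂ⟦X⟧} {F K : ℂ → ℂ}

lemma congr (h : SumsTo a F) (hF : ∀ q : ℂ, ‖q‖ < 1 → F q = K q) : SumsTo a K :=
  fun q hq => hF q hq ▸ h q hq

lemma summable_norm (h : SumsTo a F) {q : ℂ} (hq : ‖q‖ < 1) :
    Summable fun n => ‖coeff n a * q ^ n‖ :=
  summable_norm_iff.mpr (h q hq).summable

lemma add (ha : SumsTo a F) (hb : SumsTo b K) : SumsTo (a + b) (fun q => F q + K q) :=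
  fun q hq => by simpa [add_mul] using (ha q hq).add (hb q hq)

lemma sub (ha : SumsTo a F) (hb : SumsTo b K) : SumsTo (a - b) (fun q => F q - K q) :=
  fun q hq => by simpa [sub_mul] using (ha q hq).sub (hb q hq)

lemma C_mul (ha : SumsTo a F) (c : ℂ) : SumsTo (C c * a) (fun q => c * F q) :=
  fun q hq => by simpa [coeff_C_mul, mul_assoc] using (ha q hq).mul_left c

lemma one : SumsTo 1 (fun _ => 1) := fun q hq => by
  have := hasSum_ite_eq (0 : ℕ) (1 : ℂ)
  refine this.congr_fun fun n => ?_
  by_cases h : n = 0 <;> simp [h, coeff_one]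

lemma X : SumsTo X (fun q => q) := fun q hq => by
  have := hasSum_ite_eq (1 : ℕ) q
  refine this.congr_fun fun n => ?_
  by_cases h : n = 1 <;> simp [h, coeff_X]

lemma mul (ha : SumsTo a F) (hb : SumsTo b K) : SumsTo (a * b) (fun q => F q * K q) := by
  intro q hq
  have h := hasSum_sum_range_mul_of_summable_norm (ha.summable_norm hq) (hb.summable_norm hq)
  rw [(ha q hq).tsum_eq, (hb q hq).tsum_eq] at h
  refine h.congr_fun fun n => ?_
  rw [coeff_mul, Finset.Nat.sum_antidiagonal_eq_sum_range_succ_mk, Finset.sum_mul]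
  refine Finset.sum_congr rfl fun i hi => ?_
  obtain ⟨j, rfl⟩ := Nat.exists_eq_add_of_le (Nat.lt_succ_iff.mp (Finset.mem_range.mp hi))
  simp only [add_tsub_cancel_left, pow_add]
  ring

lemma pow (ha : SumsTo a F) (k : ℕ) : SumsTo (a ^ k) (fun q => F q ^ k) := by
  induction k with
  | zero => simpa using one
  | succ k ih => simpa [pow_succ] using ih.mul ha

lemma prod {ι : Type*} (s : Finset ι) {a : ι → ℂ⟦X⟧} {F : ι → ℂ → ℂ}
    (h : ∀ i, SumsTo (a i) (F i)) : SumsTo (∏ i ∈ s, a i) (fun q => ∏ i ∈ s, F i q) := by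
  classical
  induction s using Finset.induction_on with
  | empty => simpa using one
  | insert i s hi ih => simpa [Finset.prod_insert hi] using (h i).mul ih

lemma expand (ha : SumsTo a F) {l : ℕ} (hl : l ≠ 0) :
    SumsTo (a.expand l hl) (fun q => F (q ^ l)) := by
  intro q hq
  have h := ha (q ^ l) (by simpa using pow_lt_one₀ (norm_nonneg q) hq hl)
  have hinj : Function.Injective (fun n => l * n) := fun x y h => Nat.eq_of_mul_eq_mul_left (Nat.pos_of_ne_zero hl) h
  rw [← hinj.hasSum_iff]
  · simpa [Function.comp_def, pow_mul] using h
  · intro n hn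
    rw [coeff_expand_of_not_dvd, zero_mul]
    rintro ⟨m, rfl⟩
    exact hn ⟨m, rfl⟩

lemma factorial_mul_coeff (ha : SumsTo a F) (n : ℕ) :
    iteratedDeriv n F 0 = n.factorial * coeff n a := by
  have h1 : HasFPowerSeriesAt F (FormalMultilinearSeries.ofScalars ℂ fun n => coeff n a) 0 := by
    rw [hasFPowerSeriesAt_iff]
    filter_upwards [Metric.ball_mem_nhds (0 : ℂ) one_pos] with z hz
    simpa [FormalMultilinearSeries.coeff_ofScalars, mul_comm] using ha z (by simpa using hz)
  have h2 := h1.analyticAt.hasFPowerSeriesAt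
  have h3 := congrArg (fun p => p.coeff n) (h1.eq_formalMultilinearSeries h2)
  simp only [FormalMultilinearSeries.coeff_ofScalars] at h3
  rw [h3, mul_div_cancel₀ _ (by exact_mod_cast n.factorial_ne_zero)]

lemma unique (ha : SumsTo a F) (hb : SumsTo b F) : a = b := by
  ext n
  have h := (ha.factorial_mul_coeff n).symm.trans (hb.factorial_mul_coeff n)
  exact mul_left_cancel₀ (by exact_mod_cast n.factorial_ne_zero) h

lemma of_differentiableOn (hF : DifferentiableOn ℂ F (Metric.ball 0 1)) :
    SumsTo (PowerSeries.mk fun n => (n.factorial : ℂ)⁻¹ * iteratedDeriv n F 0) F := by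
  intro q hq
  refine (Complex.hasSum_taylorSeries_on_ball hF (z := q) (by simpa using hq)).congr_fun
    fun n => ?_
  simp only [coeff_mk, sub_zero, smul_eq_mul]
  ring

end SumsTo

lemma TendstoLocallyUniformlyOn.iteratedDeriv {ι : Type*} {φ : Filter ι} {U : Set ℂ}
    {F : ι → ℂ → ℂ} {f : ℂ → ℂ} (hf : TendstoLocallyUniformlyOn F f φ U)
    (hF : ∀ i, DifferentiableOn ℂ (F i) U) (hU : IsOpen U) (n : ℕ) :
    TendstoLocallyUniformlyOn (fun i => iteratedDeriv n (F i)) (iteratedDeriv n f) φ U := by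
  induction n generalizing F f with
  | zero => simpa using hf
  | succ n ih =>
    simp only [iteratedDeriv_succ']
    exact ih (hf.deriv (.of_forall hF) hU) fun i => (hF i).deriv hU

lemma sumsTo_of_tendstoLocallyUniformlyOn {ι : Type*} {φ : Filter ι} [φ.NeBot]
    {a : ι → ℂ⟦X⟧} {F : ι → ℂ → ℂ} {b : ℂ⟦X⟧} {f : ℂ → ℂ} (h : ∀ i, SumsTo (a i) (F i))
    (hF : ∀ i, DifferentiableOn ℂ (F i) (Metric.ball 0 1))
    (hlim : TendstoLocallyUniformlyOn F f φ (Metric.ball 0 1))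
    (hcoeff : ∀ n, ∀ᶠ i in φ, coeff n (a i) = coeff n b) : SumsTo b f := by
  have hf := hlim.differentiableOn (.of_forall hF) Metric.isOpen_ball
  convert SumsTo.of_differentiableOn hf using 1
  ext n
  have h1 := (hlim.iteratedDeriv hF Metric.isOpen_ball n).tendsto_at
    (Metric.mem_ball_self one_pos)
  have h2 : Tendsto (fun i => _root_.iteratedDeriv n (F i) 0) φ
      (nhds (n.factorial * coeff n b)) := by
    refine tendsto_const_nhds.congr' ?_
    filter_upwards [hcoeff n] with i hi
    rw [(h i).factorial_mul_coeff, hi]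
  rw [coeff_mk, tendsto_nhds_unique h1 h2,
    inv_mul_cancel_left₀ (by exact_mod_cast n.factorial_ne_zero)]

/-- Euler's product `∏ (1 - q ^ n)` as a function on the unit disc. -/
noncomputable def eulerProd (q : ℂ) : ℂ := ∏' n : ℕ, (1 - q ^ (n + 1))

lemma map_pentagonalSeries {R S : Type*} [CommRing R] [CommRing S] (φ : R →+* S) :
    (pentagonalSeries R).map φ = pentagonalSeries S := by
  ext n
  obtain ⟨s, h1, h2⟩ := ((coeff_prod_one_sub_X_pow_eventually_eq R n).and
    (coeff_prod_one_sub_X_pow_eventually_eq S n)).exists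
  rw [coeff_map, ← h1, ← h2, ← coeff_map]
  simp [map_prod]

lemma sumsTo_eulerProd : SumsTo (pentagonalSeries ℂ) eulerProd := by
  refine sumsTo_of_tendstoLocallyUniformlyOn (φ := atTop)
    (a := fun s : Finset ℕ => ∏ n ∈ s, (1 - X ^ (n + 1)))
    (F := fun (s : Finset ℕ) q => ∏ n ∈ s, (1 - q ^ (n + 1)))
    (fun s => SumsTo.prod s fun n => SumsTo.one.sub (SumsTo.X.pow (n + 1)))
    (fun s => DifferentiableOn.fun_finsetProd fun _ _ => by fun_prop)
    ModularForm.multipliableLocallyUniformlyOn_one_sub_pow.hasProdLocallyUniformlyOn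
    (coeff_prod_one_sub_X_pow_eventually_eq ℂ)

lemma eulerProd_ne_zero {q : ℂ} (hq : ‖q‖ < 1) : eulerProd q ≠ 0 := by
  have h : Summable fun n : ℕ => ‖-q ^ (n + 1)‖ := by
    simpa using (summable_nat_add_iff 1).mpr (summable_geometric_of_lt_one (norm_nonneg _) hq)
  have := tprod_one_add_ne_zero_of_summable (f := fun n : ℕ => -q ^ (n + 1)) (fun n => ?_) h
  · simpa [eulerProd, sub_eq_add_neg] using this
  · intro h0
    have h1 : q ^ (n + 1) = 1 := by linear_combination -h0
    have h2 := pow_lt_one₀ (norm_nonneg q) hq n.succ_ne_zero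
    rw [← norm_pow, h1] at h2
    simp at h2

open scoped PowerSeries.WithPiTopology in
lemma pentagonalSeries_mul_partitionSeries : pentagonalSeries ℤ * partitionSeries = 1 := by
  let : TopologicalSpace ℤ := ⊥
  have : DiscreteTopology ℤ := ⟨rfl⟩
  have h1 := WithPiTopology.hasProd_one_sub_X_pow ℤ
  have h2 := Nat.Partition.hasProd_genFun (R := ℤ) (fun _ _ => 1)
  have h3 : Nat.Partition.genFun (R := ℤ) (fun _ _ => 1) = partitionSeries := by
    ext n
    simp [Nat.Partition.coeff_genFun, partitionSeries, Finsupp.prod]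
  rw [h3] at h2
  refine (h1.mul h2).unique ?_
  convert hasProd_one using 2 with i
  have h4 : constantCoeff ((X : ℤ⟦X⟧) ^ (i + 1)) = 0 := by simp
  have h5 := WithPiTopology.one_sub_mul_tsum_pow_of_constantCoeff_eq_zero h4
  rw [(WithPiTopology.summable_pow_of_constantCoeff_eq_zero h4).tsum_eq_zero_add] at h5
  rw [pow_zero] at h5
  refine (congrArg (fun t : ℕ → ℤ⟦X⟧ => (1 - X ^ (i + 1)) * (1 + ∑' j, t j))
    (funext fun j => ?_)).trans h5
  rw [← pow_mul]
  exact one_smul ℤ _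

lemma sumsTo_partitionSeries :
    SumsTo (partitionSeries.map (Int.castRingHom ℂ)) (fun q => (eulerProd q)⁻¹) := by
  have hd : DifferentiableOn ℂ (fun q => (eulerProd q)⁻¹) (Metric.ball 0 1) :=
    DifferentiableOn.fun_inv ModularForm.differentiableOn_tprod_one_sub_pow
      fun q hq => eulerProd_ne_zero (by simpa using hq)
  have h := SumsTo.of_differentiableOn hd
  set c := PowerSeries.mk fun n => (n.factorial : ℂ)⁻¹ *
    iteratedDeriv n (fun q => (eulerProd q)⁻¹) 0
  have h1 : pentagonalSeries ℂ * c = 1 :=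
    ((sumsTo_eulerProd.mul h).congr fun q hq => mul_inv_cancel₀ (eulerProd_ne_zero hq)).unique
      SumsTo.one
  have h2 : pentagonalSeries ℂ * partitionSeries.map (Int.castRingHom ℂ) = 1 := by
    rw [← map_pentagonalSeries (Int.castRingHom ℂ), ← map_mul,
      pentagonalSeries_mul_partitionSeries, map_one]
  rwa [← left_inv_eq_right_inv (mul_comm c _ ▸ h1) h2]

end

section

open Filter PowerSeries UpperHalfPlane MatrixGroups

lemma norm_qParam_one_lt_one (τ : ℍ) : ‖Function.Periodic.qParam 1 (τ : ℂ)‖ < 1 := by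
  simpa using norm_qParam_lt_one 1 τ

/-- Identification of the `q`-expansion of a level one form. -/
lemma qExpansion_eq_of_sumsTo {E : Type*} [FunLike E ℍ ℂ] {k : ℤ} [ModularFormClass E 𝒮ℒ k]
    (F : E) {a : ℂ⟦X⟧} {K : ℂ → ℂ} (ha : SumsTo a K)
    (h : ∀ τ : ℍ, F τ = K (Function.Periodic.qParam 1 τ)) : qExpansion 1 F = a := by
  ext m
  refine (ModularFormClass.qExpansion_coeff_unique (c := fun m => coeff m a) one_pos
    one_mem_strictPeriods_SL (f := F) (fun τ => ?_) m).symm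
  rw [h]
  simpa using ha _ (norm_qParam_one_lt_one τ)

lemma qExpansion_discriminant :
    qExpansion 1 CuspForm.discriminant =
      (X * pentagonalSeries ℤ ^ 24).map (Int.castRingHom ℂ) := by
  have h : (X * pentagonalSeries ℤ ^ 24).map (Int.castRingHom ℂ) =
      X * pentagonalSeries ℂ ^ 24 := by
    simp [map_pentagonalSeries]
  rw [h]
  refine qExpansion_eq_of_sumsTo _ (SumsTo.X.mul (sumsTo_eulerProd.pow 24)) fun τ => ?_
  rw [CuspForm.coe_discriminant, ModularForm.discriminant_eq_q_prod, eulerProd,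
    Multipliable.tprod_pow]
  exact ModularForm.multipliable_one_sub_pow (norm_qParam_one_lt_one τ)

/-- The series of the Eisenstein series of weight four. -/
noncomputable def eisensteinFour : ℤ⟦X⟧ :=
  PowerSeries.mk fun n => if n = 0 then 1 else 240 * (ArithmeticFunction.sigma 3 n : ℤ)

lemma qExpansion_eisensteinFour :
    qExpansion 1 (ModularForm.E (k := 4) (by norm_num)) =
      eisensteinFour.map (Int.castRingHom ℂ) := by
  ext m
  rw [EisensteinSeries.E_qExpansion_coeff _ (by decide)]
  have hb : bernoulli 4 = -1 / 30 := by
    rw [bernoulli_eq_bernoulli'_of_ne_one (by decide), bernoulli'_four]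
  by_cases h : m = 0 <;> simp [h, eisensteinFour, hb]
  norm_num

lemma map_eisensteinFour : eisensteinFour.map (Int.castRingHom (ZMod 2)) = 1 := by
  ext n
  have : (240 : ZMod 2) = 0 := by decide
  by_cases h : n = 0 <;> simp [h, eisensteinFour, coeff_one, this]

lemma map_intCast_injective : Function.Injective (PowerSeries.map (Int.castRingHom ℂ)) :=
  PowerSeries.map_injective _ Int.cast_injective

/-- Modulo two, level one modular forms of weight `4 * m` with integral coefficients are
polynomials in `Δ`. -/
lemma exists_mod_two_eq_sum (m : ℕ) : ∀ (k : ℤ) (_ : k = 4 * m) (F : ModularForm 𝒮ℒ k)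
    (a : ℤ⟦X⟧) (_ : qExpansion 1 F = a.map (Int.castRingHom ℂ)),
    ∃ c : ℕ → ZMod 2, a.map (Int.castRingHom (ZMod 2)) =
      ∑ j ∈ Finset.range (m / 3 + 1), C (c j) * (X * pentagonalSeries (ZMod 2) ^ 24) ^ j := by
  induction m using Nat.strong_induction_on with
  | _ m ih =>
  intro k hk F a ha
  set e := eisensteinFour
  let E : ModularForm 𝒮ℒ k :=
    ((ModularForm.E (k := 4) (by norm_num)).pow m).mcast (by rw [hk]; push_cast; ring)
  have hE : qExpansion 1 E = (e ^ m).map (Int.castRingHom ℂ) := by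
    rw [map_pow, ← qExpansion_eisensteinFour,
      ← ModularForm.qExpansion_pow one_pos one_mem_strictPeriods_SL]
    rfl
  set a₀ : ℤ := coeff 0 a with ha₀
  let g : ModularForm 𝒮ℒ k := F - (a₀ : ℂ) • E
  have hg : qExpansion 1 g = (a - C a₀ * e ^ m).map (Int.castRingHom ℂ) := by
    have h1 : qExpansion 1 g = qExpansion 1 F - qExpansion 1 ((a₀ : ℂ) • E) :=
      ModularForm.qExpansion_sub one_pos one_mem_strictPeriods_SL F ((a₀ : ℂ) • E)
    have h2 : qExpansion 1 ((a₀ : ℂ) • E) = (a₀ : ℂ) • qExpansion 1 E :=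
      ModularForm.qExpansion_smul one_pos one_mem_strictPeriods_SL _ E
    rw [h1, h2, ha, hE, map_sub, map_mul, smul_eq_C_mul]
    simp
  have he0 : coeff 0 (e ^ m) = 1 := by simp [e, eisensteinFour]
  have hd0 : coeff 0 (a - C a₀ * e ^ m) = 0 := by
    rw [map_sub, coeff_C_mul, he0, ha₀]; ring
  have hcusp : (qExpansion 1 g).coeff 0 = 0 := by
    rw [hg, coeff_map, hd0, map_zero]
  have hmod : (C a₀ * e ^ m).map (Int.castRingHom (ZMod 2)) = C (a₀ : ZMod 2) := by
    rw [map_mul, map_pow, map_eisensteinFour]; simp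
  set g' := CuspForm.discriminantEquiv (ModularForm.toCuspForm g hcusp) with hg'
  have hq := ModularForm.qExpansion_eq_qExpansion_discriminant_mul g hcusp
  rw [← CuspForm.coe_discriminant, qExpansion_discriminant, hg] at hq
  by_cases hm : m < 3
  · have h0 : (g' : ℍ → ℂ) = 0 :=
      ModularFormClass.levelOne_neg_weight_eq_zero (k := k - 12) (by omega) g'
    rw [← hg', h0, qExpansion_zero, mul_zero, ← map_zero (PowerSeries.map (Int.castRingHom ℂ))]
      at hq
    have h1 := map_intCast_injective hq
    refine ⟨fun _ => a₀, ?_⟩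
    rw [sub_eq_zero.mp h1, hmod]
    simp [Nat.div_eq_of_lt hm]
  · obtain ⟨b, hb⟩ := X_dvd_iff.mpr (by simpa using hd0 : constantCoeff (a - C a₀ * e ^ m) = 0)
    have hfG : pentagonalSeries ℤ ^ 24 * partitionSeries ^ 24 = 1 := by
      rw [← mul_pow, pentagonalSeries_mul_partitionSeries, one_pow]
    set D : ℤ⟦X⟧ := X * pentagonalSeries ℤ ^ 24
    have hb' : a - C a₀ * e ^ m = D * (b * partitionSeries ^ 24) := by
      rw [hb]; linear_combination -(X * b) * hfG
    have hD : D.map (Int.castRingHom ℂ) ≠ 0 := by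
      rw [← map_zero (PowerSeries.map (Int.castRingHom ℂ))]
      refine map_intCast_injective.ne (mul_ne_zero X_ne_zero ?_)
      exact left_ne_zero_of_mul_eq_one hfG
    rw [hb', map_mul] at hq
    have hq' := mul_left_cancel₀ hD hq
    obtain ⟨c, hc⟩ := ih (m - 3) (by omega) (k - 12) (by omega) g' _ hq'.symm
    refine ⟨fun j => Nat.casesOn j (a₀ : ZMod 2) c, ?_⟩
    have hdiv : m / 3 = (m - 3) / 3 + 1 := by omega
    rw [hdiv, Finset.sum_range_succ', sub_eq_iff_eq_add.mp hb', map_add, hmod, map_mul, hc,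
      Finset.mul_sum]
    simp only [D, map_mul, map_pow, map_X, map_pentagonalSeries, pow_zero, mul_one]
    congr 1
    refine Finset.sum_congr rfl fun j _ => ?_
    rw [pow_succ]
    ring

end

section

open Filter Complex UpperHalfPlane ModularGroup MatrixGroups ModularForm
open UpperHalfPlane hiding I

theorem qParam_pow_eight (z : ℂ) : Function.Periodic.qParam 24 z ^ 8 = Function.Periodic.qParam 3 z := by
  simp only [Function.Periodic.qParam, ← Complex.exp_nat_mul]
  congr 1
  push_cast
  ring

theorem eta_pow_eight_eq (z : ℂ) :
    ModularForm.eta z ^ 8 = Function.Periodic.qParam 3 z *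
      eulerProd (Function.Periodic.qParam 1 z) ^ 8 := by
  rw [ModularForm.eta, mul_pow, qParam_pow_eight]
  rfl

/-- The eighth power of the Dedekind eta function on the upper half plane. -/
noncomputable def etaEight (z : ℍ) : ℂ := ModularForm.eta z ^ 8

/-- The exponent of the cube root of unity by which `η ^ 8` transforms under `SL(2, ℤ)`. -/
def etaExponent (γ : SL(2, ℤ)) : ZMod 3 :=
  ((γ 0 0 : ZMod 3) + (γ 1 1 : ZMod 3)) * (γ 1 0 : ZMod 3)
    - (γ 0 1 : ZMod 3) * (γ 1 1 : ZMod 3) * ((γ 1 0 : ZMod 3) ^ 2 - 1)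

theorem etaExponent_mul (x γ : SL(2, ℤ)) (hx : x ∈ ({S, T, S⁻¹, T⁻¹} : Set SL(2, ℤ))) :
    etaExponent (x * γ) = etaExponent x + etaExponent γ := by
  have hdet : (γ 0 0 : ZMod 3) * (γ 1 1 : ZMod 3) - (γ 0 1 : ZMod 3) * (γ 1 0 : ZMod 3) = 1 := by
    have := γ.det_coe
    rw [Matrix.det_fin_two] at this
    exact_mod_cast congrArg (Int.cast : ℤ → ZMod 3) this
  have key : ∀ a b c d : ZMod 3, a * d - b * c = 1 →
      ((-c + b) * a - (-d) * b * (a ^ 2 - 1) = (a + d) * c - b * d * (c ^ 2 - 1)) ∧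
      ((c + (-b)) * (-a) - d * (-b) * ((-a) ^ 2 - 1) = (a + d) * c - b * d * (c ^ 2 - 1)) ∧
      ((a + c + d) * c - (b + d) * d * (c ^ 2 - 1) = 1 + ((a + d) * c - b * d * (c ^ 2 - 1))) ∧
      ((a - c + d) * c - (b - d) * d * (c ^ 2 - 1) = -1 + ((a + d) * c - b * d * (c ^ 2 - 1))) := by
    decide
  obtain ⟨h1, h2, h3, h4⟩ := key _ _ _ _ hdet
  rcases hx with rfl | rfl | rfl | rfl
  · simpa [etaExponent, coe_S, Matrix.SpecialLinearGroup.coe_mul, Matrix.mul_apply, Fin.sum_univ_two] using h1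
  · simpa [etaExponent, coe_T, Matrix.SpecialLinearGroup.coe_mul, Matrix.mul_apply, Fin.sum_univ_two] using h3
  · simpa [etaExponent, coe_S, Matrix.SpecialLinearGroup.coe_mul, Matrix.SpecialLinearGroup.coe_inv, Matrix.mul_apply, Fin.sum_univ_two, Matrix.adjugate_fin_two] using h2
  · simpa [etaExponent, coe_T, Matrix.SpecialLinearGroup.coe_mul, Matrix.SpecialLinearGroup.coe_inv, Matrix.mul_apply, Fin.sum_univ_two, Matrix.adjugate_fin_two,
      sub_eq_add_neg] using h4

theorem stdAddChar_three_one : ZMod.stdAddChar (1 : ZMod 3) = Complex.exp (2 * Real.pi * Complex.I / 3) := by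
  have := ZMod.stdAddChar_coe (N := 3) 1
  simpa using this

theorem etaEight_slash_T :
    etaEight ∣[(4 : ℤ)] T = (ZMod.stdAddChar (1 : ZMod 3) : ℂ) • etaEight := by
  ext z
  rw [SL_slash_apply, modular_T_smul]
  have h1 : denom (T : SL(2, ℤ)) z = 1 := by simp [denom_apply, coe_T]
  rw [h1]
  simp only [etaEight, Pi.smul_apply, smul_eq_mul, one_zpow, mul_one, eta_pow_eight_eq,
    stdAddChar_three_one]
  have h2 : ((((1 : ℝ) +ᵥ z : ℍ) : ℂ)) = z + 1 := by simp [add_comm]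
  have h3 : Function.Periodic.qParam 1 ((z : ℂ) + 1) = Function.Periodic.qParam 1 z := by
    rw [Function.Periodic.qParam, Function.Periodic.qParam, mul_add, add_div, Complex.exp_add]
    simp
  rw [h2, h3, ← mul_assoc]
  congr 1
  simp only [Function.Periodic.qParam, ← Complex.exp_add]
  congr 1
  push_cast
  ring

theorem etaEight_slash_S : etaEight ∣[(4 : ℤ)] S = etaEight := by
  ext z
  have hz := z.ne_zero
  have hs : ∀ w : ℂ, w ≠ 0 → sqrt w ^ 8 = w ^ 4 := by
    intro w hw
    rw [sqrt_eq_exp hw, ← exp_nat_mul]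
    ring_nf
    rw [show (log w * 4) = (4 : ℕ) * log w by push_cast; ring, exp_nat_mul, exp_log hw]
  have h : ModularForm.eta (-1 / z) = (sqrt Complex.I)⁻¹ * (sqrt z * ModularForm.eta z) :=
    eta_comp_eq_csqrt_I_inv z.2
  rw [SL_slash_apply, modular_S_smul, denom_S]
  simp only [etaEight]
  have h2 : ((-z : ℂ)⁻¹) = -1 / z := by rw [neg_div, one_div, inv_neg]
  rw [UpperHalfPlane.coe_mk, h2, h, mul_pow, mul_pow, inv_pow, hs _ Complex.I_ne_zero, hs _ hz, I_pow_four]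
  rw [zpow_neg, zpow_ofNat]
  field_simp

theorem etaEight_slash (γ : SL(2, ℤ)) :
    etaEight ∣[(4 : ℤ)] γ = (ZMod.stdAddChar (etaExponent γ) : ℂ) • etaEight := by
  have hmul : ∀ x ∈ ({S, T, S⁻¹, T⁻¹} : Set SL(2, ℤ)),
      etaEight ∣[(4 : ℤ)] x = (ZMod.stdAddChar (etaExponent x) : ℂ) • etaEight →
      ∀ γ : SL(2, ℤ), etaEight ∣[(4 : ℤ)] γ = (ZMod.stdAddChar (etaExponent γ) : ℂ) • etaEight →
      etaEight ∣[(4 : ℤ)] (x * γ) =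
        (ZMod.stdAddChar (etaExponent (x * γ)) : ℂ) • etaEight := by
    intro x hx hx' γ hγ
    rw [SlashAction.slash_mul, hx', SL_smul_slash, hγ, etaExponent_mul x γ hx,
      AddChar.map_add_eq_mul, mul_smul]
  have hS : etaEight ∣[(4 : ℤ)] S = (ZMod.stdAddChar (etaExponent S) : ℂ) • etaEight := by
    simp [etaEight_slash_S, etaExponent, coe_S]
  have hT : etaEight ∣[(4 : ℤ)] T = (ZMod.stdAddChar (etaExponent T) : ℂ) • etaEight := by
    simp [etaEight_slash_T, etaExponent, coe_T]
  have hinv : ∀ x ∈ ({S, T} : Set SL(2, ℤ)),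
      etaEight ∣[(4 : ℤ)] x = (ZMod.stdAddChar (etaExponent x) : ℂ) • etaEight →
      etaEight ∣[(4 : ℤ)] x⁻¹ = (ZMod.stdAddChar (etaExponent x⁻¹) : ℂ) • etaEight := by
    intro x hx hx'
    have h1 : etaExponent x + etaExponent x⁻¹ = 0 := by
      rw [← etaExponent_mul _ _ (by rcases hx with rfl | rfl <;> simp), mul_inv_cancel]
      simp [etaExponent]
    have h2 := congrArg (fun f => f ∣[(4 : ℤ)] x⁻¹) hx'
    simp only [← SlashAction.slash_mul, mul_inv_cancel, SlashAction.slash_one, SL_smul_slash] at h2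
    conv_rhs => rw [h2]
    rw [smul_smul, ← AddChar.map_add_eq_mul, add_comm, h1, AddChar.map_zero_eq_one, one_smul]
  have : γ ∈ Subgroup.closure {S, T} := by simp [SpecialLinearGroup.SL2Z_generators]
  induction this using Subgroup.closure_induction_left with
  | one => simp [etaExponent]
  | mul_left x hx y _ ih =>
    rcases hx with rfl | rfl
    · exact hmul _ (by simp) hS _ ih
    · exact hmul _ (by simp) hT _ ih
  | inv_mul_cancel x hx y _ ih =>
    rcases hx with rfl | rfl
    · exact hmul _ (by simp) (hinv _ (by simp) hS) _ ih
    · exact hmul _ (by simp) (hinv _ (by simp) hT) _ ih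

end

section

open Filter PowerSeries
open ModularGroup MatrixGroups ModularForm
open UpperHalfPlane hiding I

lemma IsPrimitiveRoot.sum_pow_mul {l : ℕ} {ω : ℂ} (hω : IsPrimitiveRoot ω l) (n : ℕ) :
    ∑ j ∈ Finset.range l, (ω ^ j) ^ n = if l ∣ n then (l : ℂ) else 0 := by
  simp only [← pow_mul, mul_comm _ n]
  simp only [pow_mul]
  split_ifs with h
  · rw [(hω.pow_eq_one_iff_dvd n).2 h]
    simp
  · have h1 : ω ^ n ≠ 1 := fun h' => h ((hω.pow_eq_one_iff_dvd n).1 h')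
    rw [geom_sum_eq h1, ← pow_mul, mul_comm, pow_mul, hω.pow_eq_one]
    simp

lemma SumsTo.hasSum_decimate {a : ℂ⟦X⟧} {F : ℂ → ℂ} (ha : SumsTo a F) {l : ℕ} (hl : l ≠ 0)
    {ω : ℂ} (hω : IsPrimitiveRoot ω l) {x : ℂ} (hx : ‖x‖ < 1) :
    HasSum (fun n => coeff n (decimate l a) * (x ^ l) ^ n)
      ((l : ℂ)⁻¹ * ∑ j ∈ Finset.range l, F (x * ω ^ j)) := by
  have hnorm : ∀ j, ‖x * ω ^ j‖ < 1 := fun j => by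
    rw [norm_mul, norm_pow, hω.norm'_eq_one hl]
    simpa using hx
  have h1 := (hasSum_sum fun j (_ : j ∈ Finset.range l) => ha _ (hnorm j)).mul_left (l : ℂ)⁻¹
  have h2 : (fun n => (l : ℂ)⁻¹ * ∑ j ∈ Finset.range l, coeff n a * (x * ω ^ j) ^ n) =
      fun n => if l ∣ n then coeff n a * x ^ n else 0 := by
    ext n
    simp only [mul_pow, ← mul_assoc, ← Finset.mul_sum, hω.sum_pow_mul]
    split_ifs
    · field_simp
    · simp
  rw [h2] at h1
  have hinj : Function.Injective fun n : ℕ => l * n :=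
    fun _ _ h => Nat.eq_of_mul_eq_mul_left (Nat.pos_of_ne_zero hl) h
  rw [← hinj.hasSum_iff] at h1
  · refine h1.congr_fun fun n => ?_
    simp [PowerSeries.decimate, pow_mul]
  · intro n hn
    rw [if_neg]
    rintro ⟨m, rfl⟩
    exact hn ⟨m, rfl⟩

lemma SumsTo.decimate {a : ℂ⟦X⟧} {F : ℂ → ℂ} (ha : SumsTo a F) {l : ℕ} (hl : l ≠ 0) :
    SumsTo (decimate l a) fun q => ∑' n, coeff n (PowerSeries.decimate l a) * q ^ n := by
  intro q hq
  obtain ⟨x, rfl⟩ := IsAlgClosed.exists_pow_nat_eq q (Nat.pos_of_ne_zero hl)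
  have hx : ‖x‖ < 1 := by
    rw [norm_pow] at hq
    exact (pow_lt_one_iff_of_nonneg (norm_nonneg _) hl).1 hq
  exact (ha.hasSum_decimate hl (Complex.isPrimitiveRoot_exp l hl) hx).summable.hasSum

lemma eta_pow_eight_neg_inv {z : ℂ} (hz : 0 < z.im) :
    ModularForm.eta (-1 / z) ^ 8 = z ^ 4 * ModularForm.eta z ^ 8 := by
  have h := congrFun etaEight_slash_S ⟨z, hz⟩
  rw [SL_slash_apply, modular_S_smul, denom_S] at h
  have hz0 : z ≠ 0 := by rintro rfl; simp at hz
  simp only [etaEight] at h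
  rw [← h, neg_div, one_div, inv_neg, zpow_neg, zpow_ofNat]
  field_simp

lemma eta_pow_eight_twist {z : ℂ} (hz : 0 < z.im) {l : ℕ} (hl : l ≠ 0) {i j : ℤ}
    (hij : (l : ℤ) ∣ 576 * i * j + 1) :
    ModularForm.eta ((-1 / z + 24 * i) / l) ^ 8 =
      z ^ 4 * ModularForm.eta ((z + 24 * j) / l) ^ 8 := by
  obtain ⟨b, hb⟩ := hij
  let γ : SL(2, ℤ) := ⟨!![24 * i, -b; l, -24 * j], by
    rw [Matrix.det_fin_two_of]
    linarith⟩
  have hlR : (0 : ℝ) < l := by positivity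
  have hw : 0 < ((z + 24 * j) / l).im := by
    rw [Complex.div_natCast_im]
    have : (z + 24 * j).im = z.im := by simp
    rw [this]
    positivity
  set w : ℍ := ⟨(z + 24 * j) / l, hw⟩ with hwdef
  have hz0 : z ≠ 0 := by rintro rfl; simp at hz
  have hl0 : (l : ℂ) ≠ 0 := by exact_mod_cast hl
  have hγ : etaExponent γ = 0 := by
    have : (24 : ZMod 3) = 0 := by decide
    simp [etaExponent, γ, this]
  have h := congrFun (etaEight_slash γ) w
  have hd : denom γ w = z := by
    rw [denom_apply]
    simp only [γ, hwdef]
    simp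
    field_simp
    ring
  have hbC : (576 * i * j + 1 : ℂ) = l * b := by exact_mod_cast hb
  have hs : ((γ • w : ℍ) : ℂ) = (-1 / z + 24 * i) / l := by
    rw [UpperHalfPlane.coe_specialLinearGroup_apply]
    simp only [γ, hwdef]
    simp
    have hden : (l : ℂ) * ((z + 24 * j) / l) + -(24 * j) = z := by
      field_simp
      ring
    rw [hden]
    field_simp
    linear_combination hbC
  rw [SL_slash_apply, hd, hγ] at h
  simp only [etaEight, hs, Pi.smul_apply, AddChar.map_zero_eq_one, one_smul] at h
  have hwc : (w : ℂ) = (z + 24 * j) / l := rfl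
  rw [hwc] at h
  rw [← h, zpow_neg, zpow_ofNat]
  field_simp

end

section

open Filter PowerSeries
open ModularGroup MatrixGroups ModularForm
open UpperHalfPlane hiding I

/-- The trace-like combination of eta quotients of weight `4 * k * (l - 1)` attached to a prime
`l`. -/
noncomputable def etaTrace (k l : ℕ) (z : ℂ) : ℂ :=
  (ModularForm.eta z ^ 8) ^ (k * l) * (((ModularForm.eta (l * z) ^ 8) ^ k)⁻¹ +
    (l : ℂ) ^ (4 * k) * ∑ j ∈ Finset.range l, ((ModularForm.eta ((z + 24 * j) / l) ^ 8) ^ k)⁻¹)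

lemma im_add_mul_div_pos {z : ℂ} (hz : 0 < z.im) {l : ℕ} (hl : 0 < l) (j : ℕ) :
    0 < ((z + 24 * j) / l).im := by
  rw [Complex.div_natCast_im]
  have : (z + 24 * j).im = z.im := by simp
  rw [this]
  positivity

lemma sum_eta_neg_inv {k l : ℕ} (hl : l.Prime) (h6 : Nat.Coprime 6 l) {z : ℂ} (hz : 0 < z.im) :
    ∑ j ∈ (Finset.range l).erase 0, ((ModularForm.eta ((-1 / z + 24 * (j : ℕ)) / l) ^ 8) ^ k)⁻¹ =
      (z ^ (4 * k))⁻¹ *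
        ∑ j ∈ (Finset.range l).erase 0, ((ModularForm.eta ((z + 24 * (j : ℕ)) / l) ^ 8) ^ k)⁻¹ := by
  have : Fact l.Prime := ⟨hl⟩
  have h576 : (576 : ZMod l) ≠ 0 := by
    have h1 : Nat.Coprime 576 l := by
      rw [show 576 = 6 ^ 2 * 2 ^ 4 by norm_num]
      exact Nat.Coprime.mul_left (h6.pow_left 2)
        ((Nat.Coprime.coprime_dvd_left (by norm_num) h6).pow_left 4)
    intro h
    have h2 : l ∣ 576 := (ZMod.natCast_eq_zero_iff 576 l).1 (by exact_mod_cast h)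
    exact hl.one_lt.ne' (Nat.Coprime.eq_one_of_dvd h1.symm h2)
  let σ : ℕ → ℕ := fun j => (-(576 * (j : ZMod l))⁻¹).val
  have hne : ∀ j ∈ (Finset.range l).erase 0, (j : ZMod l) ≠ 0 := by
    intro j hj h
    rw [Finset.mem_erase, Finset.mem_range] at hj
    exact hj.1 (Nat.eq_zero_of_dvd_of_lt ((ZMod.natCast_eq_zero_iff j l).1 h) hj.2)
  have hσ : ∀ j ∈ (Finset.range l).erase 0, σ j ∈ (Finset.range l).erase 0 := by
    intro j hj
    rw [Finset.mem_erase, Finset.mem_range]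
    refine ⟨?_, ZMod.val_lt _⟩
    simp only [σ, ne_eq, ZMod.val_eq_zero, neg_eq_zero, _root_.inv_eq_zero, mul_eq_zero, not_or]
    exact ⟨h576, hne j hj⟩
  have hσσ : ∀ j ∈ (Finset.range l).erase 0, σ (σ j) = j := by
    intro j hj
    have h0 := hne j hj
    have h1 : (-(576 * ((σ j : ℕ) : ZMod l))⁻¹) = j := by
      simp only [σ, ZMod.natCast_val, ZMod.cast_id', id_eq]
      field_simp
    simp only [σ] at h1 ⊢
    rw [h1]
    rw [Finset.mem_erase, Finset.mem_range] at hj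
    exact ZMod.val_cast_of_lt hj.2
  rw [Finset.mul_sum]
  refine Finset.sum_nbij' σ σ hσ hσ hσσ hσσ fun j hj => ?_
  have hdvd : (l : ℤ) ∣ 576 * j * (σ j : ℕ) + 1 := by
    rw [← ZMod.intCast_zmod_eq_zero_iff_dvd]
    have h0 := hne j hj
    push_cast
    simp only [σ, ZMod.natCast_val, ZMod.cast_id', id_eq]
    field_simp
    ring
  have h := eta_pow_eight_twist hz hl.ne_zero hdvd
  simp only [Int.cast_natCast] at h
  rw [h, mul_pow, mul_inv, pow_mul]

lemma etaTrace_neg_inv {k l : ℕ} (hl : l.Prime) (h6 : Nat.Coprime 6 l) {z : ℂ} (hz : 0 < z.im) :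
    etaTrace k l (-1 / z) = z ^ (4 * (k * (l - 1))) * etaTrace k l z := by
  have hl0 : (l : ℂ) ≠ 0 := by exact_mod_cast hl.ne_zero
  have hlR : (0 : ℝ) < l := by exact_mod_cast hl.pos
  have hz0 : z ≠ 0 := by rintro rfl; simp at hz
  have h0 : (0 : ℕ) ∈ Finset.range l := by simpa using hl.pos
  simp only [etaTrace]
  rw [← Finset.add_sum_erase _ _ h0, ← Finset.add_sum_erase _ _ h0,
    sum_eta_neg_inv hl h6 hz, eta_pow_eight_neg_inv hz]
  have hz1 : 0 < (z / l).im := by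
    rw [Complex.div_natCast_im]
    positivity
  have hz2 : 0 < (l * z).im := by
    have : (l * z).im = l * z.im := by simp
    rw [this]
    positivity
  have h1 : ModularForm.eta (l * (-1 / z)) ^ 8 = (z / l) ^ 4 * ModularForm.eta (z / l) ^ 8 := by
    rw [← eta_pow_eight_neg_inv hz1]
    congr 2
    field_simp
  have h2 : ModularForm.eta (-1 / z / l) ^ 8 = (l * z) ^ 4 * ModularForm.eta (l * z) ^ 8 := by
    rw [← eta_pow_eight_neg_inv hz2]
    congr 2
    field_simp
  have h3 : k * l = k * (l - 1) + k := by
    rw [← Nat.mul_succ, Nat.succ_eq_add_one, Nat.sub_add_cancel hl.one_le]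
  simp only [Nat.cast_zero, mul_zero, add_zero]
  rw [h1, h2]
  generalize ModularForm.eta (z / l) ^ 8 = A
  generalize ModularForm.eta (l * z) ^ 8 = B
  generalize (∑ j ∈ (Finset.range l).erase 0, ((ModularForm.eta ((z + 24 * (j : ℕ)) / l) ^ 8) ^ k)⁻¹) = D
  have e1 : ((z / l) ^ 4 * A) ^ k = (z ^ (4 * k)) * ((l : ℂ) ^ (4 * k))⁻¹ * A ^ k := by
    rw [mul_pow, div_pow, div_pow, ← pow_mul, ← pow_mul]; rfl
  have e2 : ((l * z) ^ 4 * B) ^ k = (l : ℂ) ^ (4 * k) * z ^ (4 * k) * B ^ k := by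
    rw [mul_pow, mul_pow, mul_pow, ← pow_mul, ← pow_mul]
  have e3 : (z ^ 4 * ModularForm.eta z ^ 8) ^ (k * l) =
      z ^ (4 * (k * (l - 1))) * z ^ (4 * k) * (ModularForm.eta z ^ 8) ^ (k * l) := by
    rw [mul_pow, ← pow_mul, ← pow_add, ← mul_add, ← h3]
  rw [e1, e2, e3]
  have hzk : z ^ (4 * k) ≠ 0 := pow_ne_zero _ hz0
  have hlk : (l : ℂ) ^ (4 * k) ≠ 0 := pow_ne_zero _ hl0
  generalize z ^ (4 * k) = Z at *
  generalize (l : ℂ) ^ (4 * k) = L at *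
  simp only [mul_inv, inv_inv]
  field_simp
  ring


lemma twentyFour_dvd_sq_sub_one {l : ℕ} (h6 : Nat.Coprime 6 l) : 24 ∣ l ^ 2 - 1 := by
  have h2 : l % 2 ≠ 0 := fun h =>
    absurd (Nat.dvd_gcd (show 2 ∣ 6 by norm_num) (Nat.dvd_of_mod_eq_zero h)) (by simp [h6.gcd_eq_one])
  have h3 : l % 3 ≠ 0 := fun h =>
    absurd (Nat.dvd_gcd (show 3 ∣ 6 by norm_num) (Nat.dvd_of_mod_eq_zero h)) (by simp [h6.gcd_eq_one])
  refine (Nat.modEq_iff_dvd' (Nat.one_le_pow _ _ (by lia))).1 ?_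
  have h : ∀ r < 24, r % 2 ≠ 0 → r % 3 ≠ 0 → 1 % 24 = r ^ 2 % 24 := by decide
  rw [Nat.ModEq, Nat.pow_mod]
  exact h _ (Nat.mod_lt _ (by norm_num)) (by lia) (by lia)

/-- The integral `q`-expansion of `etaTrace`. -/
noncomputable def etaTraceSeries (k l : ℕ) (hl : l ≠ 0) : ℤ⟦X⟧ :=
  pentagonalSeries ℤ ^ (8 * (k * l)) * ((partitionSeries ^ (8 * k)).expand l hl +
    C ((l : ℤ) ^ (4 * k + 1)) * decimate l (X ^ (k * ((l ^ 2 - 1) / 3)) * partitionSeries ^ (8 * k)))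

lemma map_decimate {R S : Type*} [CommRing R] [CommRing S] (φ : R →+* S) (l : ℕ) (F : R⟦X⟧) :
    (decimate l F).map φ = decimate l (F.map φ) := by
  ext n
  simp [decimate]

lemma eta_pow_eight_inv_eq (w : ℂ) (k : ℕ) :
    ((ModularForm.eta w ^ 8) ^ k)⁻¹ = (Function.Periodic.qParam 3 w ^ k)⁻¹ *
      (eulerProd (Function.Periodic.qParam 1 w))⁻¹ ^ (8 * k) := by
  rw [eta_pow_eight_eq, mul_pow, mul_inv, ← pow_mul, inv_pow]

lemma exists_sumsTo_etaTraceSeries {k l : ℕ} (hl : l ≠ 0) (h6 : Nat.Coprime 6 l) :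
    ∃ K : ℂ → ℂ, SumsTo ((etaTraceSeries k l hl).map (Int.castRingHom ℂ)) K ∧
      ∀ z : ℂ, 0 < z.im → etaTrace k l z = K (Function.Periodic.qParam 1 z) := by
  have hl0 : (l : ℂ) ≠ 0 := by exact_mod_cast hl
  set P := partitionSeries.map (Int.castRingHom ℂ) with hP
  set s := k * ((l ^ 2 - 1) / 3) with hs
  have hPs : SumsTo (X ^ s * P ^ (8 * k)) (fun q => q ^ s * (eulerProd q)⁻¹ ^ (8 * k)) :=
    (SumsTo.X.pow s).mul (sumsTo_partitionSeries.pow (8 * k))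
  have hmap : (etaTraceSeries k l hl).map (Int.castRingHom ℂ) =
      pentagonalSeries ℂ ^ (8 * (k * l)) * ((P ^ (8 * k)).expand l hl +
        C ((l : ℂ) ^ (4 * k + 1)) * decimate l (X ^ s * P ^ (8 * k))) := by
    simp [etaTraceSeries, map_pentagonalSeries, map_decimate, map_expand, hP, hs]
  refine ⟨_, hmap ▸ (sumsTo_eulerProd.pow _).mul (((sumsTo_partitionSeries.pow _).expand hl).add
    ((hPs.decimate hl).C_mul _)), fun z hz => ?_⟩
  set x := Function.Periodic.qParam 1 (z / l) with hx
  have hxl : x ^ l = Function.Periodic.qParam 1 z := by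
    rw [hx, Function.Periodic.qParam, Function.Periodic.qParam, ← Complex.exp_nat_mul]
    congr 1
    field_simp
  have hx1 : ‖x‖ < 1 := by
    refine Function.Periodic.norm_qParam_lt_one one_pos ?_
    rw [Complex.div_natCast_im]
    have : (0 : ℝ) < l := by positivity
    positivity
  set ω : ℂ := Complex.exp (2 * Real.pi * Complex.I / l) ^ 24 with hω
  have hωp : IsPrimitiveRoot ω l :=
    (Complex.isPrimitiveRoot_exp l hl).pow_of_coprime 24 (by
      rw [show 24 = 6 * 2 ^ 2 by norm_num]
      exact Nat.Coprime.mul_left h6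
        ((Nat.Coprime.coprime_dvd_left (by norm_num) h6).pow_left 2))
  have h1 := (hPs.hasSum_decimate hl hωp hx1).tsum_eq
  rw [hxl] at h1
  have h3s : 3 * s = k * (l ^ 2 - 1) := by
    rw [hs, mul_left_comm, Nat.mul_div_cancel' (dvd_trans (by norm_num) (twentyFour_dvd_sq_sub_one h6))]
  have h3s' : 3 * s + k = k * l * l := by
    rw [h3s, mul_assoc, ← sq]
    have : 1 ≤ l ^ 2 := Nat.one_le_pow _ _ (Nat.pos_of_ne_zero hl)
    rw [← Nat.mul_succ, Nat.succ_eq_add_one, Nat.sub_add_cancel this]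
  have hq1 : Function.Periodic.qParam 3 (l * z) = Function.Periodic.qParam 3 z ^ l := by
    rw [Function.Periodic.qParam, Function.Periodic.qParam, ← Complex.exp_nat_mul]
    congr 1
    ring
  have hq2 : Function.Periodic.qParam 1 (l * z) = Function.Periodic.qParam 1 z ^ l := by
    rw [Function.Periodic.qParam, Function.Periodic.qParam, ← Complex.exp_nat_mul]
    congr 1
    ring
  have hq3 (j : ℕ) : Function.Periodic.qParam 1 ((z + 24 * j) / l) = x * ω ^ j := by
    rw [hx, hω, Function.Periodic.qParam, Function.Periodic.qParam, ← pow_mul, ← Complex.exp_nat_mul,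
      ← Complex.exp_add]
    congr 1
    push_cast
    field_simp
  have hq4 (j : ℕ) : Function.Periodic.qParam 3 z ^ (k * l) =
      Function.Periodic.qParam 3 ((z + 24 * j) / l) ^ k * (x * ω ^ j) ^ s := by
    rw [← hq3]
    simp only [Function.Periodic.qParam, ← Complex.exp_nat_mul, ← Complex.exp_add]
    rw [Complex.exp_eq_exp_iff_exists_int]
    refine ⟨-(8 * j * k * l), ?_⟩
    have h3c : (3 * s + k : ℂ) = k * l * l := by exact_mod_cast h3s'
    push_cast
    field_simp
    linear_combination (-(z + 24 * j)) * h3c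
  have hq5 : ∀ (h : ℝ) (w : ℂ), Function.Periodic.qParam h w ≠ 0 := fun h w =>
    Function.Periodic.qParam_ne_zero w
  simp only [etaTrace, eta_pow_eight_inv_eq, hq1, hq2, hq3, h1, mul_add]
  congr 1
  · rw [eta_pow_eight_eq, mul_pow, ← pow_mul, ← pow_mul, mul_comm l k]
    have := pow_ne_zero (k * l) (hq5 3 z)
    field_simp
  · simp only [Finset.mul_sum]
    refine Finset.sum_congr rfl fun j _ => ?_
    rw [eta_pow_eight_eq, mul_pow, hq4 j, ← pow_mul]
    have := pow_ne_zero k (hq5 3 ((z + 24 * j) / l))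
    clear_value ω
    field_simp
    ring

end

section

open Filter PowerSeries
open ModularGroup MatrixGroups ModularForm
open UpperHalfPlane hiding I

/-- A holomorphic function with a convergent `q`-expansion satisfying the weight `k`
transformation law under inversion is a modular form of level one. -/
lemma exists_modularForm_of_sumsTo {f : ℂ → ℂ} (hf : DifferentiableOn ℂ f {z | 0 < z.im})
    {a : ℂ⟦X⟧} {K : ℂ → ℂ} (ha : SumsTo a K)
    (hK : ∀ z : ℂ, 0 < z.im → f z = K (Function.Periodic.qParam 1 z)) (k : ℕ)
    (hS : ∀ z : ℂ, 0 < z.im → f (-1 / z) = z ^ k * f z) :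
    ∃ F : ModularForm 𝒮ℒ (k : ℤ), qExpansion 1 F = a := by
  set g : ℍ → ℂ := fun z => f z with hg
  have hgS : g ∣[(k : ℤ)] S = g := by
    ext z
    have hz0 := z.ne_zero
    rw [SL_slash_apply, modular_S_smul, denom_S]
    simp only [hg]
    rw [← one_div, div_neg, ← neg_div, hS z z.2, zpow_neg, zpow_natCast]
    field_simp
  have hgT : g ∣[(k : ℤ)] T = g := by
    ext z
    rw [SL_slash_apply, modular_T_smul]
    have h1 : denom (T : SL(2, ℤ)) z = 1 := by simp [denom_apply, coe_T]
    have h3 : Function.Periodic.qParam 1 ((z : ℂ) + 1) = Function.Periodic.qParam 1 z := by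
      rw [Function.Periodic.qParam, Function.Periodic.qParam, mul_add, add_div, Complex.exp_add]
      simp
    rw [h1]
    simp only [hg, one_zpow, mul_one]
    rw [hK _ ((1 : ℝ) +ᵥ z).2, hK _ z.2, ← h3]
    congr 2
    simp [add_comm]
  have hb : IsBoundedAtImInfty g :=
    isBoundedAtImInfty_of_hasSum_qExpansion (c := fun n => coeff n a) one_pos fun τ => by
      simp only [hg, hK _ τ.2]
      simpa using ha _ (norm_qParam_one_lt_one τ)
  let F : ModularForm 𝒮ℒ (k : ℤ) :=
    { toFun := g
      slash_action_eq' := by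
        rintro A ⟨A, rfl⟩
        exact SlashInvariantForm.slash_action_generators_SL2Z hgS hgT A
      holo' := by
        rw [UpperHalfPlane.mdifferentiable_iff]
        refine hf.congr fun z hz => ?_
        simp [hg, ofComplex_apply_of_im_pos hz]
      bdd_at_cusps' := by
        intro c hc
        rw [Subgroup.IsArithmetic.isCusp_iff_isCusp_SL2Z] at hc
        rw [OnePoint.isBoundedAt_iff_forall_SL2Z hc]
        intro γ _
        rw [SlashInvariantForm.slash_action_generators_SL2Z hgS hgT]
        exact hb }
  exact ⟨F, qExpansion_eq_of_sumsTo F ha fun τ => hK τ τ.2⟩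

lemma differentiableOn_etaTrace (k : ℕ) {l : ℕ} (hl : 0 < l) :
    DifferentiableOn ℂ (etaTrace k l) {z | 0 < z.im} := by
  intro z hz
  refine DifferentiableAt.differentiableWithinAt ?_
  have h1 : DifferentiableAt ℂ ModularForm.eta z := differentiableAt_eta_of_mem_upperHalfPlaneSet hz
  have hlz : 0 < ((l : ℂ) * z).im := by
    have : ((l : ℂ) * z).im = l * z.im := by simp
    rw [this]
    exact mul_pos (by exact_mod_cast hl) hz
  have h2 : DifferentiableAt ℂ (fun z => ModularForm.eta (l * z)) z :=
    DifferentiableAt.comp z (differentiableAt_eta_of_mem_upperHalfPlaneSet hlz) (by fun_prop)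
  have h3 (j : ℕ) : DifferentiableAt ℂ (fun z => ModularForm.eta ((z + 24 * j) / l)) z :=
    DifferentiableAt.comp z (f := fun z => (z + 24 * (j : ℂ)) / (l : ℂ))
      (differentiableAt_eta_of_mem_upperHalfPlaneSet
      (im_add_mul_div_pos hz hl j)) (by fun_prop)
  refine ((h1.pow 8).pow _).mul ((DifferentiableAt.inv ((h2.pow 8).pow k) ?_).add
    ((DifferentiableAt.fun_sum fun j _ => DifferentiableAt.inv (((h3 j).pow 8).pow k) ?_).const_mul _))
  · exact pow_ne_zero _ (pow_ne_zero _ (eta_ne_zero hlz))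
  · exact pow_ne_zero _ (pow_ne_zero _ (eta_ne_zero (im_add_mul_div_pos hz hl j)))

lemma exists_mod_two_etaTraceSeries {k l : ℕ} (hl : l.Prime) (h6 : Nat.Coprime 6 l) :
    ∃ c : ℕ → ZMod 2, (etaTraceSeries k l hl.ne_zero).map (Int.castRingHom (ZMod 2)) =
      ∑ j ∈ Finset.range (k * (l - 1) / 3 + 1),
        C (c j) * (X * pentagonalSeries (ZMod 2) ^ 24) ^ j := by
  obtain ⟨K, hK, hK'⟩ := exists_sumsTo_etaTraceSeries (k := k) hl.ne_zero h6
  obtain ⟨F, hF⟩ := exists_modularForm_of_sumsTo (differentiableOn_etaTrace k hl.pos) hK hK'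
    (4 * (k * (l - 1))) fun z hz => etaTrace_neg_inv hl h6 hz
  exact exists_mod_two_eq_sum (k * (l - 1)) _ (by push_cast; ring) F _ hF

end

section

open Filter PowerSeries

lemma pow_eight_eq_expand (F : (ZMod 2)⟦X⟧) : F ^ 8 = F.expand 8 (by norm_num) := by
  have h2 : ∀ F : (ZMod 2)⟦X⟧, F ^ 2 = F.expand 2 two_ne_zero := fun F => by
    have h := MvPowerSeries.map_frobenius_expand 2 two_ne_zero (R := ZMod 2) (f := F)
    rw [ZMod.frobenius_zmod] at h
    rw [← h]
    ext n
    simp [expand]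
  rw [show F ^ 8 = ((F ^ 2) ^ 2) ^ 2 by ring, h2, h2, h2, ← expand_mul, ← expand_mul]

namespace PowerSeries

variable {R : Type*} [CommRing R]

lemma decimate_add (l : ℕ) (F G : R⟦X⟧) : decimate l (F + G) = decimate l F + decimate l G := by
  ext n
  simp [decimate]

lemma decimate_sum (l : ℕ) {ι : Type*} (s : Finset ι) (F : ι → R⟦X⟧) :
    decimate l (∑ i ∈ s, F i) = ∑ i ∈ s, decimate l (F i) := by
  ext n
  simp [decimate]

lemma decimate_C_mul (l : ℕ) (c : R) (F : R⟦X⟧) : decimate l (C c * F) = C c * decimate l F := by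
  ext n
  simp [decimate]

lemma decimate_decimate (l m : ℕ) (F : R⟦X⟧) :
    decimate l (decimate m F) = decimate m (decimate l F) := by
  ext n
  simp only [decimate, coeff_mk, mul_left_comm l m]

lemma decimate_X_pow_mul_expand {l : ℕ} (hl : l ≠ 0) (j : ℕ) (F : R⟦X⟧) :
    decimate l (X ^ j * F.expand l hl) = if l ∣ j then X ^ (j / l) * F else 0 := by
  ext n
  have hl' := Nat.pos_of_ne_zero hl
  simp only [decimate, coeff_mk, coeff_X_pow_mul']
  split_ifs with h1 h2 h2
  · obtain ⟨i, rfl⟩ := h2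
    rw [← Nat.mul_sub, coeff_expand_mul, Nat.mul_div_cancel_left _ hl', coeff_X_pow_mul',
      if_pos (Nat.le_of_mul_le_mul_left h1 hl')]
  · rw [coeff_expand_of_not_dvd, map_zero]
    intro h3
    exact h2 ((Nat.dvd_sub_iff_right h1 (dvd_mul_right l n)).1 h3)
  · obtain ⟨i, rfl⟩ := h2
    rw [Nat.mul_div_cancel_left _ hl', coeff_X_pow_mul', if_neg]
    exact fun h => h1 (Nat.mul_le_mul_left l h)
  · simp

end PowerSeries

lemma coprime_six_iff {n : ℕ} : Nat.Coprime 6 n ↔ n % 6 = 1 ∨ n % 6 = 5 := by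
  rw [Nat.Coprime, Nat.gcd_rec]
  have : n % 6 < 6 := Nat.mod_lt _ (by norm_num)
  generalize n % 6 = r at *
  interval_cases r <;> decide

lemma sparse_partitionSeries_pow
    (h1 : SparseSeries (partitionSeries.map (Int.castRingHom (ZMod 2)))) (A : ℕ)
    (hA : Nat.Coprime 6 A) :
    SparseSeries (partitionSeries.map (Int.castRingHom (ZMod 2)) ^ A) := by
  induction A using Nat.strong_induction_on with
  | _ A ih =>
  by_cases hA1 : A = 1
  · simpa [hA1] using h1
  set l := A.minFac with hl
  have hlp : l.Prime := Nat.minFac_prime hA1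
  obtain ⟨k, hk⟩ : l ∣ A := Nat.minFac_dvd A
  have hA0 : 0 < A := Nat.pos_of_ne_zero fun h => by simp [h] at hA
  have hk0 : 0 < k := Nat.pos_of_ne_zero fun h => by simp [h] at hk; omega
  have hkA : k < A := by
    rw [hk]
    exact lt_mul_of_one_lt_left hk0 hlp.one_lt
  have h6l : Nat.Coprime 6 l := Nat.Coprime.coprime_dvd_right ⟨k, hk⟩ hA
  have h6k : Nat.Coprime 6 k := Nat.Coprime.coprime_dvd_right ⟨l, by rw [hk, mul_comm]⟩ hA
  have hl0 := hlp.ne_zero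
  clear_value l
  obtain ⟨c, hc⟩ := exists_mod_two_etaTraceSeries (k := k) hlp h6l
  set g := partitionSeries.map (Int.castRingHom (ZMod 2)) with hg
  set f := pentagonalSeries (ZMod 2) with hf
  have hfg : f * g = 1 := by
    have := congrArg (PowerSeries.map (Int.castRingHom (ZMod 2))) pentagonalSeries_mul_partitionSeries
    simpa [map_pentagonalSeries] using this
  obtain ⟨r, hr⟩ := twentyFour_dvd_sq_sub_one h6l
  have hr0 : r ≠ 0 := by
    rintro rfl
    have := Nat.pow_lt_pow_left hlp.one_lt two_ne_zero
    omega
  have hs : k * ((l ^ 2 - 1) / 3) = 8 * (k * r) := by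
    rw [hr, show 24 * r = 3 * (8 * r) by ring, Nat.mul_div_cancel_left _ (by norm_num)]
    ring
  have hlodd : (l : ZMod 2) = 1 := by
    have := coprime_six_iff.1 h6l
    rw [ZMod.natCast_eq_one_iff_odd, Nat.odd_iff]
    omega
  have hlX : (l : (ZMod 2)⟦X⟧) = 1 := by
    rw [← map_natCast C, hlodd, map_one]
  set E := (g ^ (8 * k)).expand l hl0 + decimate l (X ^ (8 * (k * r)) * g ^ (8 * k)) with hE
  have hmap : (etaTraceSeries k l hl0).map (Int.castRingHom (ZMod 2)) = f ^ (8 * (k * l)) * E := by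
    simp [etaTraceSeries, map_pentagonalSeries, map_decimate, map_expand, hs, hlX, hE, hg, hf]
  rw [hmap] at hc
  have hc0 : c 0 = 1 := by
    have h := congrArg constantCoeff hc
    have hf0 : constantCoeff f * constantCoeff g = 1 := by simpa using congrArg constantCoeff hfg
    have hfz : ∀ x y : ZMod 2, x * y = 1 → x = 1 ∧ y = 1 := by decide
    obtain ⟨hf1, hg1⟩ := hfz _ _ hf0
    have hd : constantCoeff (decimate l (X ^ (8 * (k * r)) * g ^ (8 * k))) = 0 := by
      rw [← coeff_zero_eq_constantCoeff_apply, decimate, coeff_mk, mul_zero, coeff_X_pow_mul',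
        if_neg]
      have := Nat.mul_pos hk0 (Nat.pos_of_ne_zero hr0)
      omega
    rw [Finset.sum_range_succ'] at h
    simpa [hE, hf1, hg1, hd] using h.symm
  have hsum : E = ∑ j ∈ Finset.range (k * (l - 1) / 3 + 1),
      C (c j) * (X ^ j * (g ^ (k * l - 3 * j)).expand 8 (by norm_num)) := by
    have h := congrArg (fun F => g ^ (8 * (k * l)) * F) hc
    simp only [← mul_assoc, ← mul_pow, mul_comm g f, hfg, one_pow, one_mul] at h
    rw [h, Finset.mul_sum]
    refine Finset.sum_congr rfl fun j hj => ?_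
    rw [Finset.mem_range] at hj
    have hjle : 3 * j ≤ k * l := by
      have := Nat.mul_le_mul_left k (Nat.sub_le l 1)
      omega
    rw [← pow_eight_eq_expand, ← pow_mul]
    have h24 : g ^ (8 * k * l) = g ^ (24 * j) * g ^ ((k * l - 3 * j) * 8) := by
      rw [← pow_add, mul_assoc]
      congr 1
      omega
    rw [h24, mul_pow, ← pow_mul]
    have hfg' : f ^ (24 * j) * g ^ (24 * j) = 1 := by rw [← mul_pow, hfg, one_pow]
    linear_combination (C (c j) * X ^ j * g ^ ((k * l - 3 * j) * 8)) * hfg'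
  have hsum8 := congrArg (decimate 8) hsum
  have hgk : g ^ (8 * k) = (g ^ k).expand 8 (by norm_num) := by
    rw [mul_comm, pow_mul, pow_eight_eq_expand]
  have hE8 : decimate 8 E = (g ^ k).expand l hl0 + decimate l (X ^ (k * r) * g ^ k) := by
    rw [hE, decimate_add, decimate_decimate, hgk, decimate_X_pow_mul_expand, if_pos (dvd_mul_right _ _),
      Nat.mul_div_cancel_left _ (by norm_num)]
    congr 1
    ext n
    simp only [decimate, coeff_mk, ← expand_mul]
    simp only [mul_comm l 8]
    rw [expand_mul 8 (by norm_num) l hl0, coeff_expand_mul]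
  rw [hE8, decimate_sum, Finset.sum_range_succ'] at hsum8
  simp only [decimate_C_mul, decimate_X_pow_mul_expand] at hsum8
  have hAeq : A = k * l := by rw [hk, mul_comm]
  have hfin : g ^ A = ((g ^ k).expand l hl0 + decimate l (X ^ (k * r) * g ^ k)) +
      ∑ j ∈ Finset.range (k * (l - 1) / 3), C (c (j + 1)) *
        (if 8 ∣ j + 1 then X ^ ((j + 1) / 8) * g ^ (k * l - 3 * (j + 1)) else 0) := by
    rw [hsum8, hc0, hAeq]
    have h2 : ∀ F : (ZMod 2)⟦X⟧, F + F = 0 := fun F => by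
      ext n
      simp [CharTwo.add_self_eq_zero]
    rw [add_right_comm, h2]
    simp
  rw [hfin]
  have hgks := ih k hkA h6k
  refine ((hgks.expand hl0).add ((hgks.X_pow_mul _).decimate hlp.pos)).add
    (SparseSeries.sum _ _ fun j hj => SparseSeries.C_mul ?_ _)
  split_ifs with h8
  · rw [Finset.mem_range] at hj
    have h3 : 3 * (j + 1) ≤ k * (l - 1) := by omega
    have h4 : k * (l - 1) < k * l := Nat.mul_lt_mul_of_pos_left (Nat.sub_lt hlp.pos one_pos) hk0
    refine (ih _ (by omega) ?_).X_pow_mul _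
    rw [coprime_six_iff] at hA ⊢
    omega
  · exact SparseSeries.zero

end

/-- If `δ_A > 0` for some `A ≡ ±1 (mod 6)`, and `δ_i` exists for all
`i ≤ A` with `i ≡ ±1 (mod 6)`, then `δ_1 > 0`. -/
theorem positive_odd_density_of_partition_function
    (A : ℕ) (hA0 : 0 < A) (hA6 : A % 6 = 1 ∨ A % 6 = 5)
    (hex : ∀ i : ℕ, 0 < i → i ≤ A → (i % 6 = 1 ∨ i % 6 = 5) →
      ∃ δ : ℝ, hasOddDensity i δ)
    (hApos : ∃ δA : ℝ, hasOddDensity A δA ∧ 0 < δA) :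
    ∃ δ₁ : ℝ, hasOddDensity 1 δ₁ ∧ 0 < δ₁ := by
  obtain ⟨δ, hδ⟩ := hex 1 one_pos hA0 (by norm_num)
  obtain ⟨δA, hδA, hpos⟩ := hApos
  refine ⟨δ, hδ, lt_of_le_of_ne (ge_of_tendsto' hδ fun x => by positivity) fun h => ?_⟩
  subst h
  have h1 := (sparse_partitionSeries_pow_iff 1).2 hδ
  rw [pow_one] at h1
  have hA := (sparse_partitionSeries_pow_iff A).1
    (sparse_partitionSeries_pow h1 A (coprime_six_iff.2 hA6))
  exact hpos.ne' (tendsto_nhds_unique hδA hA)
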